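/- arXiv:1605.04400 — 5 statements merged into one kernel-verified Lean document; each statement's English description precedes it below -/
import Mathlib

section
/- For every LTL formula φ over a finite set AP of atomic propositions and every infinite word π ∈ (2^AP)^ω: π satisfies φ if and only if π ∈ L(A_φ), where A_φ is the generalized Büchi automaton constructed from φ. -/
open scoped ENNReal

/-- LTL formulas over atomic propositions `AP`. -/
inductive LTL (AP : Type) : Type
  | atom : AP → LTL AP
  | neg : LTL AP → LTL AP
  | conj : LTL AP → LTL AP → LTL AP
  | next : LTL AP → LTL AP
  | untl : LTL AP → LTL AP → LTL AP

namespace LTL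

/-- Semantics of LTL over infinite words `w : ℕ → Set AP`. -/
def Sat {AP : Type} : (ℕ → Set AP) → LTL AP → Prop
  | w, atom p => p ∈ w 0
  | w, neg φ => ¬ Sat w φ
  | w, conj φ ψ => Sat w φ ∧ Sat w ψ
  | w, next φ => Sat (fun i => w (i + 1)) φ
  | w, untl φ ψ =>
      ∃ j : ℕ, Sat (fun i => w (i + j)) ψ ∧ ∀ i < j, Sat (fun k => w (k + i)) φ

/-- `Subf ψ φ` : `ψ` is a subformula of `φ`. -/
inductive Subf {AP : Type} : LTL AP → LTL AP → Prop
  | refl (φ : LTL AP) : Subf φ φ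
  | negI {ψ φ : LTL AP} : Subf ψ φ → Subf ψ (neg φ)
  | conjL {ψ φ₁ φ₂ : LTL AP} : Subf ψ φ₁ → Subf ψ (conj φ₁ φ₂)
  | conjR {ψ φ₁ φ₂ : LTL AP} : Subf ψ φ₂ → Subf ψ (conj φ₁ φ₂)
  | nextI {ψ φ : LTL AP} : Subf ψ φ → Subf ψ (next φ)
  | untlL {ψ φ₁ φ₂ : LTL AP} : Subf ψ φ₁ → Subf ψ (untl φ₁ φ₂)
  | untlR {ψ φ₁ φ₂ : LTL AP} : Subf ψ φ₂ → Subf ψ (untl φ₁ φ₂)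

/-- Elementary formulas `el φ`. -/
def el {AP : Type} : LTL AP → Set (LTL AP)
  | atom _ => ∅
  | neg ψ => el ψ
  | conj φ ψ => el φ ∪ el ψ
  | next ψ => insert (next ψ) (el ψ)
  | untl φ ψ => insert (next (untl φ ψ)) (el φ ∪ el ψ)

/-- The satisfaction relation `(V, a) ⊩ ψ`. -/
def sd {AP : Type} (V : Set (LTL AP)) (a : Set AP) : LTL AP → Prop
  | atom p => p ∈ a
  | neg ψ => ¬ sd V a ψ
  | conj φ ψ => sd V a φ ∧ sd V a ψ
  | next ψ => next ψ ∈ V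
  | untl φ ψ => sd V a ψ ∨ (sd V a φ ∧ next (untl φ ψ) ∈ V)

end LTL

/-- A generalized Büchi automaton with alphabet `Al` and state space `Q`. -/
structure GBA (Al : Type) (Q : Type) where
  T : Q → Al → Set Q
  init : Set Q
  acc : Set (Set (Q × Al × Q))

namespace GBA

variable {Al Q : Type}

/-- A run of the automaton over the word `w`. -/
def IsRun (Au : GBA Al Q) (w : ℕ → Al) (ρ : ℕ → Q) : Prop :=
  ρ 0 ∈ Au.init ∧ ∀ i, ρ (i + 1) ∈ Au.T (ρ i) (w i)

/-- An accepting run: for each accepting set, some transition in it occurs at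
infinitely many positions. -/
def IsAcceptingRun (Au : GBA Al Q) (w : ℕ → Al) (ρ : ℕ → Q) : Prop :=
  Au.IsRun w ρ ∧ ∀ F ∈ Au.acc, {i : ℕ | (ρ i, w i, ρ (i + 1)) ∈ F}.Infinite

/-- The language of the automaton. -/
def Lang (Au : GBA Al Q) : Set (ℕ → Al) :=
  {w | ∃ ρ : ℕ → Q, Au.IsAcceptingRun w ρ}

/-- The automaton `Au` with single initial state `q`. -/
def from1 (Au : GBA Al Q) (q : Q) : GBA Al Q :=
  { Au with init := {q} }

/-- The language of the automaton started in state `q`. -/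
def LangFrom (Au : GBA Al Q) (q : Q) : Set (ℕ → Al) :=
  (Au.from1 q).Lang

/-- Separated automaton: distinct states recognize disjoint languages. -/
def Separated (Au : GBA Al Q) : Prop :=
  ∀ q q' : Q, q ≠ q' → Au.LangFrom q ∩ Au.LangFrom q' = ∅

/-- Reverse determinism: every state has exactly one `a`-predecessor for each letter `a`. -/
def RevDet (Au : GBA Al Q) : Prop :=
  ∀ (q' : Q) (a : Al), ∃! q : Q, q' ∈ Au.T q a

/-- Fully partitioned automaton: separated, every word is accepted from some
state, and reverse deterministic. -/
def FullyPartitioned (Au : GBA Al Q) : Prop :=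
  Au.Separated ∧ (∀ w : ℕ → Al, ∃ q : Q, w ∈ Au.LangFrom q) ∧ Au.RevDet

/-- A state is reenterable if it has some predecessor. -/
def Reenterable (Au : GBA Al Q) (q : Q) : Prop :=
  ∃ (p : Q) (a : Al), q ∈ Au.T p a

/-- The restriction of an automaton to its reenterable states, all of them initial. -/
def restrict (Au : GBA Al Q) : GBA Al {q : Q // Au.Reenterable q} where
  T q a := {q' | q'.1 ∈ Au.T q.1 a}
  init := Set.univ
  acc := (fun F => {t : {q : Q // Au.Reenterable q} × Al × {q : Q // Au.Reenterable q} |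
            (t.1.1, t.2.1, t.2.2.1) ∈ F}) '' Au.acc

/-- Almost fully partitioned: the restriction to reenterable states is fully partitioned. -/
def AlmostFullyPartitioned (Au : GBA Al Q) : Prop :=
  Au.restrict.FullyPartitioned

end GBA

/-- The transition function of the automaton `A_φ`; the state `none` is the
initial state `φ`, the state `some V` is the subset state `V ⊆ el φ`. -/
def autT {AP : Type} (φ : LTL AP) :
    Option (Set (LTL AP)) → Set AP → Set (Option (Set (LTL AP)))
  | none, a => {q' | ∃ V : Set (LTL AP), q' = some V ∧ V ⊆ φ.el ∧ LTL.sd V a φ}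
  | some V, a => {q' | ∃ U : Set (LTL AP), q' = some U ∧ U ⊆ φ.el ∧
      ∀ ψ : LTL AP, LTL.next ψ ∈ φ.el → (LTL.next ψ ∈ V ↔ LTL.sd U a ψ)}

/-- The generalized Büchi automaton `A_φ` of an LTL formula `φ`. -/
def aut {AP : Type} (φ : LTL AP) : GBA (Set AP) (Option (Set (LTL AP))) where
  T := autT φ
  init := {none}
  acc := {F | ∃ φ₁ φ₂ : LTL AP, LTL.Subf (LTL.untl φ₁ φ₂) φ ∧
    F = {t : Option (Set (LTL AP)) × Set AP × Option (Set (LTL AP)) |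
          t.2.2 ∈ autT φ t.1 t.2.1 ∧
          ∃ V : Set (LTL AP), t.2.2 = some V ∧
            (LTL.sd V t.2.1 φ₂ ∨ ¬ LTL.sd V t.2.1 (LTL.untl φ₁ φ₂))}}

/-- The automaton `A_φ^U` for `U ⊆ el φ`. -/
def autFrom {AP : Type} (φ : LTL AP) (U : Set (LTL AP)) :
    GBA (Set AP) (Option (Set (LTL AP))) :=
  (aut φ).from1 (some U)

/-- A (finite, labelled) Markov chain with state space `S` and labels in `Al`. -/
structure MC (S : Type) (Al : Type) where
  L : S → Al
  init : S
  P : S → S → ℝ≥0∞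

namespace MC

variable {S Al : Type}

/-- The edge relation of the underlying graph of the Markov chain. -/
def E (M : MC S Al) : S → S → Prop := fun s s' => 0 < M.P s s'

/-- The labelled word generated by a path of the Markov chain. -/
def word (M : MC S Al) (π : ℕ → S) : ℕ → Al := fun i => M.L (π i)

end MC

/-- The edge relation of the product graph `A × M`. -/
def prodE {S Al Q : Type} (Au : GBA Al Q) (M : MC S Al) : Q × S → Q × S → Prop :=
  fun v v' => M.E v.2 v'.2 ∧ v'.1 ∈ Au.T v.1 (M.L v.2)

/-- All vertices of `C` are mutually reachable. -/
def MutReach {V : Type} (E : V → V → Prop) (C : Set V) : Prop :=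
  ∀ u ∈ C, ∀ v ∈ C, Relation.ReflTransGen E u v

/-- `C` is a (non-extensible, i.e. maximal) strongly connected component. -/
def IsSCC {V : Type} (E : V → V → Prop) (C : Set V) : Prop :=
  C.Nonempty ∧ MutReach E C ∧ ∀ C' : Set V, C ⊆ C' → MutReach E C' → C' = C

/-- `SCCle E C C'` : some vertex of `C'` is reachable from some vertex of `C`. -/
def SCCle {V : Type} (E : V → V → Prop) (C C' : Set V) : Prop :=
  ∃ u ∈ C, ∃ v ∈ C', Relation.ReflTransGen E u v

/-- A bottom SCC: an SCC maximal with respect to reachability. -/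
def IsBSCC {V : Type} (E : V → V → Prop) (C : Set V) : Prop :=
  IsSCC E C ∧ ∀ C' : Set V, IsSCC E C' → SCCle E C C' → C' = C

/-- A finite path of the graph `E` lying in the set `C`. -/
def FinPathIn {V : Type} (E : V → V → Prop) (C : Set V) (l : List V) : Prop :=
  l.Chain' E ∧ ∀ v ∈ l, v ∈ C

/-- An infinite path of the graph `E` lying in the set `C`. -/
def InfPathIn {V : Type} (E : V → V → Prop) (C : Set V) (π : ℕ → V) : Prop :=
  (∀ i, E (π i) (π (i + 1))) ∧ ∀ i, π i ∈ C

/-- The infinite path `π` visits the finite path `l` infinitely often, i.e. `l`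
occurs as a contiguous fragment starting at infinitely many positions of `π`. -/
def VisitsInfOften {V : Type} (π : ℕ → V) (l : List V) : Prop :=
  {n : ℕ | ∀ i : Fin l.length, π (n + i.1) = l.get i}.Infinite

/-- The projection `H(C)` of a set of product vertices to the Markov chain. -/
def Hproj {Q S : Type} (C : Set (Q × S)) : Set S := Prod.snd '' C

/-- A complete SCC of the product graph: every finite path of `H(C)` is the
projection of some finite path in `C`. -/
def CompleteSCC {S Al Q : Type} (Au : GBA Al Q) (M : MC S Al) (C : Set (Q × S)) : Prop :=
  ∀ l : List S, FinPathIn M.E (Hproj C) l →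
    ∃ σ : List (Q × S), FinPathIn (prodE Au M) C σ ∧ σ.map Prod.snd = l

/-- An accepting SCC of the product graph. -/
def AcceptingSCC {S Al Q : Type} (Au : GBA Al Q) (M : MC S Al) (C : Set (Q × S)) : Prop :=
  ∀ F ∈ Au.acc, ∃ v ∈ C, ∃ v' ∈ C, prodE Au M v v' ∧ (v.1, M.L v.2, v'.1) ∈ F

/-- A locally positive SCC: accepting, complete, and `H(C)` is a bottom SCC of
the underlying graph of `M`. -/
def LocallyPositive {S Al Q : Type} (Au : GBA Al Q) (M : MC S Al) (C : Set (Q × S)) : Prop :=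
  AcceptingSCC Au M C ∧ CompleteSCC Au M C ∧ IsBSCC M.E (Hproj C)

/-- The σ-algebra on `ℕ → S` generated by the cylinder sets. -/
def CylSigma (S : Type) : MeasurableSpace (ℕ → S) :=
  MeasurableSpace.generateFrom
    {A : Set (ℕ → S) | ∃ l : List S, A = {π | ∀ i : Fin l.length, π i.1 = l.get i}}

/-- `μ` is the path measure of the Markov chain with transition matrix `P` and
initial state `s`: the measure of each cylinder is the product of the transition
probabilities along it. -/
def IsPathMeasure {S : Type} [DecidableEq S] (P : S → S → ℝ≥0∞) (s : S)
    (μ : @MeasureTheory.Measure (ℕ → S) (CylSigma S)) : Prop :=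
  ∀ (k : ℕ) (f : ℕ → S),
    μ {π | ∀ i ≤ k, π i = f i} =
      (if f 0 = s then 1 else 0) * ∏ i ∈ Finset.range k, P (f i) (f (i + 1))

/-- A predicate satisfying the expansion law of "until" whose eventuality is never postponed
forever is the "until" of its two arguments. -/
theorem until_iff_of_expansion {P A B : ℕ → Prop}
    (expand : ∀ i, P i ↔ B i ∨ (A i ∧ P (i + 1)))
    (fair : ∀ n, ∃ m, n ≤ m ∧ (B m ∨ ¬ P m)) (i : ℕ) :
    P i ↔ ∃ j, B (i + j) ∧ ∀ k < j, A (i + k) := by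
  constructor
  · intro hP
    obtain ⟨m, him, hm⟩ := fair i
    obtain ⟨d, rfl⟩ := Nat.exists_eq_add_of_le him
    clear him
    induction d generalizing i with
    | zero => exact ⟨0, hm.resolve_right (not_not_intro hP), by simp⟩
    | succ d ih =>
      rcases (expand i).1 hP with hB | ⟨hA, hP'⟩
      · exact ⟨0, hB, by simp⟩
      · obtain ⟨j, hB, hj⟩ := ih (i + 1) hP' (by rwa [add_right_comm, add_assoc])
        refine ⟨j + 1, by rwa [add_right_comm, add_assoc] at hB, fun k hk => ?_⟩
        cases k with
        | zero => exact hA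
        | succ k =>
          have := hj k (by omega)
          rwa [add_right_comm, add_assoc] at this
  · rintro ⟨j, hB, hA⟩
    induction j generalizing i with
    | zero => exact (expand i).2 (Or.inl hB)
    | succ j ih =>
      refine (expand i).2 (Or.inr ⟨hA 0 (by omega), ih (i + 1) ?_ fun k hk => ?_⟩)
      · rwa [add_right_comm, add_assoc]
      · rw [add_right_comm, add_assoc]
        exact hA (k + 1) (by omega)

namespace LTL

variable {AP : Type}

/-- `SatAt w i ψ`: the suffix of `w` starting at position `i` satisfies `ψ`. -/
def SatAt (w : ℕ → Set AP) (i : ℕ) (ψ : LTL AP) : Prop :=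
  Sat (fun k => w (k + i)) ψ

theorem satAt_atom (w : ℕ → Set AP) (i : ℕ) (p : AP) : SatAt w i (atom p) ↔ p ∈ w i := by
  simp [SatAt, Sat]

theorem satAt_neg (w : ℕ → Set AP) (i : ℕ) (ψ : LTL AP) :
    SatAt w i (neg ψ) ↔ ¬ SatAt w i ψ := by
  simp only [SatAt, Sat]

theorem satAt_conj (w : ℕ → Set AP) (i : ℕ) (ψ χ : LTL AP) :
    SatAt w i (conj ψ χ) ↔ SatAt w i ψ ∧ SatAt w i χ := by
  simp only [SatAt, Sat]

theorem satAt_next (w : ℕ → Set AP) (i : ℕ) (ψ : LTL AP) :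
    SatAt w i (next ψ) ↔ SatAt w (i + 1) ψ := by
  simp only [SatAt, Sat, add_assoc, add_comm 1 i]

theorem satAt_untl (w : ℕ → Set AP) (i : ℕ) (ψ χ : LTL AP) :
    SatAt w i (untl ψ χ) ↔ ∃ j, SatAt w (i + j) χ ∧ ∀ k < j, SatAt w (i + k) ψ := by
  simp only [SatAt, Sat, add_assoc, add_comm i]

theorem satAt_untl_expand (w : ℕ → Set AP) (i : ℕ) (ψ χ : LTL AP) :
    SatAt w i (untl ψ χ) ↔
      SatAt w i χ ∨ (SatAt w i ψ ∧ SatAt w (i + 1) (untl ψ χ)) := by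
  simp only [satAt_untl]
  constructor
  · rintro ⟨_ | j, hχ, hψ⟩
    · exact Or.inl hχ
    · refine Or.inr ⟨hψ 0 (by omega), j, ?_, fun k hk => ?_⟩
      · rwa [add_right_comm, add_assoc]
      · rw [add_right_comm, add_assoc]
        exact hψ (k + 1) (by omega)
  · rintro (hχ | ⟨hψ, j, hχ, hj⟩)
    · exact ⟨0, hχ, by simp⟩
    · refine ⟨j + 1, by rwa [add_right_comm, add_assoc] at hχ, fun k hk => ?_⟩
      cases k with
      | zero => exact hψ
      | succ k =>
        have := hj k (by omega)
        rwa [add_right_comm, add_assoc] at this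

theorem Subf.trans {ψ χ φ : LTL AP} (h₁ : Subf ψ χ) (h₂ : Subf χ φ) : Subf ψ φ := by
  induction h₂ with
  | refl => exact h₁
  | negI _ ih => exact ih.negI
  | conjL _ ih => exact ih.conjL
  | conjR _ ih => exact ih.conjR
  | nextI _ ih => exact ih.nextI
  | untlL _ ih => exact ih.untlL
  | untlR _ ih => exact ih.untlR

theorem Subf.el_subset {ψ φ : LTL AP} (h : Subf ψ φ) : el ψ ⊆ el φ := by
  induction h with
  | refl => exact subset_rfl
  | negI _ ih => exact ih
  | conjL _ ih => exact fun _ hx => Or.inl (ih hx)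
  | conjR _ ih => exact fun _ hx => Or.inr (ih hx)
  | nextI _ ih => exact fun _ hx => Or.inr (ih hx)
  | untlL _ ih => exact fun _ hx => Or.inr (Or.inl (ih hx))
  | untlR _ ih => exact fun _ hx => Or.inr (Or.inr (ih hx))

theorem subf_of_next_mem_el {ψ φ : LTL AP} (h : next ψ ∈ el φ) : Subf ψ φ := by
  induction φ with
  | atom p => exact h.elim
  | neg φ ih => exact (ih h).negI
  | conj φ χ ihφ ihχ => exact h.elim (fun h => (ihφ h).conjL) fun h => (ihχ h).conjR
  | next φ ih =>
    rcases h with h | h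
    · cases h
      exact (Subf.refl _).nextI
    · exact (ih h).nextI
  | untl φ χ ihφ ihχ =>
    rcases h with h | h | h
    · cases h
      exact Subf.refl _
    · exact (ihφ h).untlL
    · exact (ihχ h).untlR

/-- The elementary formulas of `φ` that hold at position `i` of `w`. -/
def elAt (φ : LTL AP) (w : ℕ → Set AP) (i : ℕ) : Set (LTL AP) :=
  {χ ∈ el φ | SatAt w i χ}

theorem sd_elAt {φ ψ : LTL AP} (w : ℕ → Set AP) (i : ℕ) (h : Subf ψ φ) :
    sd (elAt φ w i) (w i) ψ ↔ SatAt w i ψ := by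
  induction ψ with
  | atom p => exact (satAt_atom w i p).symm
  | neg ψ ih => rw [satAt_neg, sd, ih ((Subf.refl _).negI.trans h)]
  | conj ψ χ ihψ ihχ =>
    rw [satAt_conj, sd, ihψ ((Subf.refl _).conjL.trans h), ihχ ((Subf.refl _).conjR.trans h)]
  | next ψ => exact and_iff_right (h.el_subset (Or.inl rfl))
  | untl ψ χ ihψ ihχ =>
    have hmem : next (untl ψ χ) ∈ elAt φ w i ↔ SatAt w i (next (untl ψ χ)) :=
      and_iff_right (h.el_subset (Or.inl rfl))
    rw [satAt_untl_expand, sd, ihψ ((Subf.refl _).untlL.trans h),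
      ihχ ((Subf.refl _).untlR.trans h), hmem, satAt_next]

/-- Along a fair sequence of locally consistent sets, `sd` agrees with the semantics. -/
theorem sd_iff_satAt {φ : LTL AP} {w : ℕ → Set AP} {V : ℕ → Set (LTL AP)}
    (step : ∀ i ψ, next ψ ∈ el φ → (next ψ ∈ V i ↔ sd (V (i + 1)) (w (i + 1)) ψ))
    (fair : ∀ φ₁ φ₂, Subf (untl φ₁ φ₂) φ → ∀ n, ∃ m, n ≤ m ∧
      (sd (V m) (w m) φ₂ ∨ ¬ sd (V m) (w m) (untl φ₁ φ₂)))
    {ψ : LTL AP} (h : Subf ψ φ) (i : ℕ) :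
    sd (V i) (w i) ψ ↔ SatAt w i ψ := by
  induction ψ generalizing i with
  | atom p => exact (satAt_atom w i p).symm
  | neg ψ ih => rw [satAt_neg, sd, ih ((Subf.refl _).negI.trans h)]
  | conj ψ χ ihψ ihχ =>
    rw [satAt_conj, sd, ihψ ((Subf.refl _).conjL.trans h), ihχ ((Subf.refl _).conjR.trans h)]
  | next ψ ih =>
    rw [satAt_next, sd, step i ψ (h.el_subset (Or.inl rfl)), ih ((Subf.refl _).nextI.trans h)]
  | untl ψ χ ihψ ihχ =>
    have expand : ∀ i, sd (V i) (w i) (untl ψ χ) ↔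
        sd (V i) (w i) χ ∨ (sd (V i) (w i) ψ ∧ sd (V (i + 1)) (w (i + 1)) (untl ψ χ)) :=
      fun i => by rw [← step i _ (h.el_subset (Or.inl rfl)), sd]
    rw [until_iff_of_expansion expand (fair ψ χ h) i, satAt_untl]
    simp only [ihψ ((Subf.refl _).untlL.trans h), ihχ ((Subf.refl _).untlR.trans h)]

end LTL

open LTL in
theorem mem_lang_aut_of_sat {AP : Type} {φ : LTL AP} {w : ℕ → Set AP} (h : Sat w φ) :
    w ∈ (aut φ).Lang := by
  have run : ∀ i, (fun i => Nat.casesOn i none fun i => some (elAt φ w i) :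
      ℕ → Option (Set (LTL AP))) (i + 1) ∈ autT φ
        (Nat.casesOn i none fun i => some (elAt φ w i)) (w i) := by
    rintro (_ | i)
    · exact ⟨_, rfl, fun _ hx => hx.1, (sd_elAt w 0 (Subf.refl φ)).2 h⟩
    · refine ⟨_, rfl, fun _ hx => hx.1, fun ψ hψ => ?_⟩
      rw [sd_elAt w (i + 1) (subf_of_next_mem_el hψ), ← satAt_next]
      exact and_iff_right hψ
  refine ⟨_, ⟨rfl, run⟩, ?_⟩
  rintro _ ⟨φ₁, φ₂, hsub, rfl⟩
  refine Set.infinite_of_forall_exists_gt fun n => ?_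
  have fair : ∃ m, n < m ∧ (SatAt w m φ₂ ∨ ¬ SatAt w m (untl φ₁ φ₂)) := by
    by_cases hn : SatAt w (n + 1) (untl φ₁ φ₂)
    · obtain ⟨j, hj, -⟩ := (satAt_untl w (n + 1) φ₁ φ₂).1 hn
      exact ⟨n + 1 + j, by omega, Or.inl hj⟩
    · exact ⟨n + 1, n.lt_succ_self, Or.inr hn⟩
  obtain ⟨m, hnm, hm⟩ := fair
  refine ⟨m, ⟨run m, elAt φ w m, rfl, ?_⟩, hnm⟩
  rwa [sd_elAt w m ((Subf.refl _).untlR.trans hsub), sd_elAt w m hsub]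

open LTL in
theorem sat_of_mem_lang_aut {AP : Type} {φ : LTL AP} {w : ℕ → Set AP}
    (h : w ∈ (aut φ).Lang) : Sat w φ := by
  obtain ⟨ρ, ⟨hinit, hrun⟩, hacc⟩ := h
  have hsome : ∀ i, ∃ V, ρ (i + 1) = some V := by
    intro i
    have hi : ρ (i + 1) ∈ autT φ (ρ i) (w i) := hrun i
    cases hρ : ρ i <;> rw [hρ] at hi <;> obtain ⟨V, hV, -⟩ := hi <;> exact ⟨V, hV⟩
  choose V hV using hsome
  have start : sd (V 0) (w 0) φ := by
    have h0 : ρ 1 ∈ autT φ (ρ 0) (w 0) := hrun 0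
    rw [show ρ 0 = none from hinit, hV 0] at h0
    obtain ⟨U, hU, -, hsd⟩ := h0
    cases hU
    exact hsd
  have step : ∀ i ψ, next ψ ∈ el φ → (next ψ ∈ V i ↔ sd (V (i + 1)) (w (i + 1)) ψ) := by
    intro i
    have hi : ρ (i + 1 + 1) ∈ autT φ (ρ (i + 1)) (w (i + 1)) := hrun (i + 1)
    rw [hV i, hV (i + 1)] at hi
    obtain ⟨U, hU, -, hstep⟩ := hi
    cases hU
    exact hstep
  have fair : ∀ φ₁ φ₂, Subf (untl φ₁ φ₂) φ → ∀ n, ∃ m, n ≤ m ∧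
      (sd (V m) (w m) φ₂ ∨ ¬ sd (V m) (w m) (untl φ₁ φ₂)) := by
    intro φ₁ φ₂ hsub n
    obtain ⟨m, ⟨-, U, hU, hm⟩, hnm⟩ := (hacc _ ⟨φ₁, φ₂, hsub, rfl⟩).exists_gt n
    cases (hV m).symm.trans hU
    exact ⟨m, hnm.le, hm⟩
  exact (sd_iff_satAt step fair (Subf.refl φ) 0).1 start

/-- For every LTL formula `φ` over a finite set `AP` and every
infinite word `π ∈ (2^AP)^ω`: `π ⊨ φ` iff `π ∈ L(A_φ)`. -/
theorem ltl_sat_iff_mem_lang_aut {AP : Type} [Fintype AP]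
    (φ : LTL AP) (π : ℕ → Set AP) :
    LTL.Sat π φ ↔ π ∈ (aut φ).Lang := by
  exact ⟨mem_lang_aut_of_sat, sat_of_mem_lang_aut⟩
end

section
/- For every LTL formula φ, every U ⊆ el(φ), and every a ∈ 2^AP, the set V₀ = {Xψ ∈ el(φ) : (U,a) ⊩ ψ} is the unique subset V ⊆ el(φ) with U ∈ T_φ(V,a); in other words, among the states 2^{el(φ)} of A_φ, every state U has exactly one a-predecessor for each letter a, so the restriction of A_φ to these (reenterable) states is reverse deterministic. -/
open scoped ENNReal

/-- Every elementary formula is a next-formula. -/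
theorem LTL.exists_eq_next_of_mem_el {AP : Type} {φ χ : LTL AP} (h : χ ∈ φ.el) :
    ∃ ψ : LTL AP, χ = LTL.next ψ := by
  induction φ with
  | atom p => exact h.elim
  | neg ψ ih => exact ih h
  | conj φ₁ φ₂ ih₁ ih₂ => exact h.elim ih₁ ih₂
  | next ψ ih => exact h.elim (fun e => ⟨ψ, e⟩) ih
  | untl φ₁ φ₂ ih₁ ih₂ => exact h.elim (fun e => ⟨_, e⟩) fun h => h.elim ih₁ ih₂

/-- For every LTL formula `φ`, every `U ⊆ el φ` and every letter
`a ∈ 2^AP`, the set `V₀ = {X ψ ∈ el φ : (U,a) ⊩ ψ}` is the unique subset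
`V ⊆ el φ` with `U ∈ T_φ(V, a)`; i.e. among the subset states of `A_φ`, every
state has exactly one `a`-predecessor, so the restriction of `A_φ` to these
(reenterable) states is reverse deterministic. -/
theorem aut_unique_predecessor {AP : Type} [Fintype AP]
    (φ : LTL AP) (U : Set (LTL AP)) (hU : U ⊆ φ.el) (a : Set AP) :
    (({χ | χ ∈ φ.el ∧ ∃ ψ : LTL AP, χ = LTL.next ψ ∧ LTL.sd U a ψ} : Set (LTL AP)) ⊆ φ.el ∧
      some U ∈ (aut φ).T
        (some {χ | χ ∈ φ.el ∧ ∃ ψ : LTL AP, χ = LTL.next ψ ∧ LTL.sd U a ψ}) a) ∧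
    ∀ V : Set (LTL AP), V ⊆ φ.el → some U ∈ (aut φ).T (some V) a →
      V = {χ | χ ∈ φ.el ∧ ∃ ψ : LTL AP, χ = LTL.next ψ ∧ LTL.sd U a ψ} := by
  refine ⟨⟨fun _ h => h.1, U, rfl, hU, fun ψ hψ => ⟨?_, fun h => ⟨hψ, ψ, rfl, h⟩⟩⟩, ?_⟩
  · rintro ⟨-, ψ', h, hs⟩
    cases h
    exact hs
  · rintro V hV ⟨U', hU', -, hT⟩
    cases hU'
    ext χ
    constructor
    · intro hχ
      obtain ⟨ψ, rfl⟩ := LTL.exists_eq_next_of_mem_el (hV hχ)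
      exact ⟨hV hχ, ψ, rfl, (hT ψ (hV hχ)).1 hχ⟩
    · rintro ⟨hχ, ψ, rfl, hs⟩
      exact (hT ψ hχ).2 hs
end

section
/- For every finite Markov chain M = (S, L, s̄, P) with labelling L : S → Σ and every generalized Büchi automaton A over the finite alphabet Σ, the set {π ∈ S^ω : L∘π ∈ L(A)} (where L∘π is the infinite word L(s₀)L(s₁)… for π = s₀s₁…) is measurable with respect to the σ-algebra on S^ω generated by the cylinder sets. -/
open scoped ENNReal

/-- A map from a filter's index type to a finite type is constant on a member of an ultrafilter. -/
theorem Ultrafilter.exists_eventually_eq_of_finite {α β : Type*} [Finite β]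
    (U : Ultrafilter α) (f : α → β) : ∃ b, ∀ᶠ a in U, f a = b := by
  obtain ⟨b, hb⟩ := Ultrafilter.eq_pure_of_finite (U.map f)
  have hmem : {b} ∈ U.map f := by rw [hb]; exact Ultrafilter.mem_pure.2 rfl
  exact ⟨b, hmem⟩

/-- For a colouring of pairs of naturals by a finite type, infinitely many `m` share their
colours at arbitrarily late positions with some fixed `n`. -/
theorem exists_frequently_eq_of_finite {X : Type*} [Finite X] (c : ℕ → ℕ → X) {Y : Type*}
    [Finite Y] (f : ℕ → Y) :
    ∃ n, ∃ᶠ m in Filter.atTop, f m = f n ∧ ∃ k ≥ m, c n k = c m k := by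
  choose d hd using fun m => (Filter.hyperfilter ℕ).exists_eventually_eq_of_finite (c m)
  obtain ⟨y, hy⟩ := Finite.exists_infinite_fiber (fun m => (d m, f m))
  have hinf : ((fun m => (d m, f m)) ⁻¹' {y}).Infinite := Set.infinite_coe_iff.1 hy
  obtain ⟨n, hn⟩ := hinf.nonempty
  refine ⟨n, (Nat.frequently_atTop_iff_infinite.2 hinf).mono fun m hm => ?_⟩
  have hnm : (d m, f m) = (d n, f n) := Eq.trans hm (Eq.symm hn)
  obtain ⟨hdm, hfm⟩ := Prod.mk.inj hnm
  have hge : ∀ᶠ k in Filter.hyperfilter ℕ, k ≥ m :=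
    Nat.hyperfilter_le_atTop (Filter.eventually_ge_atTop m)
  obtain ⟨k, hk, hck, hcm⟩ := (hge.and ((hd n).and (hd m))).exists
  exact ⟨hfm, k, hk, by rw [hck, hcm, hdm]⟩

namespace GBA

variable {Al Q : Type}

/-- `ρ` respects the transition function on the positions in `[n, m)`. -/
def IsRunOn (Au : GBA Al Q) (w : ℕ → Al) (n m : ℕ) (ρ : ℕ → Q) : Prop :=
  ∀ i ∈ Set.Ico n m, ρ (i + 1) ∈ Au.T (ρ i) (w i)

/-- The set of transitions that `ρ` takes at the positions in `[n, m)`. -/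
def transOn (w : ℕ → Al) (n m : ℕ) (ρ : ℕ → Q) : Set (Q × Al × Q) :=
  (fun i => (ρ i, w i, ρ (i + 1))) '' Set.Ico n m

/-- The triples `(p, B, q)` such that some run fragment over `w` on `[n, m)` leads from `p` to `q`
with set of transitions `B`. -/
def profile (Au : GBA Al Q) (w : ℕ → Al) (n m : ℕ) : Set (Q × Set (Q × Al × Q) × Q) :=
  {t | ∃ ρ : ℕ → Q, Au.IsRunOn w n m ρ ∧ (ρ n, transOn w n m ρ, ρ m) = t}

/-- The run `ρ` followed by `ρ'` from position `k` on. -/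
def glue (k : ℕ) (ρ ρ' : ℕ → Q) (i : ℕ) : Q := if i ≤ k then ρ i else ρ' i

theorem glue_of_le {k i : ℕ} (ρ ρ' : ℕ → Q) (h : i ≤ k) : glue k ρ ρ' i = ρ i := if_pos h

theorem glue_of_ge {k i : ℕ} {ρ ρ' : ℕ → Q} (hk : ρ k = ρ' k) (h : k ≤ i) :
    glue k ρ ρ' i = ρ' i := by
  unfold glue
  split_ifs with h'
  · rw [le_antisymm h' h, hk]
  · rfl

theorem IsRunOn.congr {Au : GBA Al Q} {w w' : ℕ → Al} {n m : ℕ} {ρ ρ' : ℕ → Q}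
    (h : Au.IsRunOn w n m ρ) (hw : ∀ i ∈ Set.Ico n m, w i = w' i)
    (hρ : ∀ i ∈ Set.Icc n m, ρ i = ρ' i) : Au.IsRunOn w' n m ρ' := fun i hi => by
  rw [← hw i hi, ← hρ i ⟨hi.1, hi.2.le⟩, ← hρ (i + 1) ⟨hi.1.trans i.le_succ, hi.2⟩]
  exact h i hi

theorem transOn_congr {w w' : ℕ → Al} {n m : ℕ} {ρ ρ' : ℕ → Q}
    (hw : ∀ i ∈ Set.Ico n m, w i = w' i) (hρ : ∀ i ∈ Set.Icc n m, ρ i = ρ' i) :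
    transOn w n m ρ = transOn w' n m ρ' :=
  Set.image_congr fun i hi => by
    rw [hw i hi, hρ i ⟨hi.1, hi.2.le⟩, hρ (i + 1) ⟨hi.1.trans i.le_succ, hi.2⟩]

theorem transOn_union (w : ℕ → Al) {n k m : ℕ} (hnk : n ≤ k) (hkm : k ≤ m) (ρ : ℕ → Q) :
    transOn w n k ρ ∪ transOn w k m ρ = transOn w n m ρ := by
  rw [transOn, transOn, transOn, ← Set.image_union, Set.Ico_union_Ico_eq_Ico hnk hkm]

theorem IsRunOn.trans {Au : GBA Al Q} {w : ℕ → Al} {n k m : ℕ} {ρ : ℕ → Q}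
    (h : Au.IsRunOn w n k ρ) (h' : Au.IsRunOn w k m ρ) : Au.IsRunOn w n m ρ := fun i hi =>
  (lt_or_ge i k).elim (fun hik => h i ⟨hi.1, hik⟩) fun hki => h' i ⟨hki, hi.2⟩

theorem IsRunOn.glue {Au : GBA Al Q} {w : ℕ → Al} {n k m : ℕ} {ρ ρ' : ℕ → Q}
    (h : Au.IsRunOn w n k ρ) (h' : Au.IsRunOn w k m ρ') (hk : ρ k = ρ' k) :
    Au.IsRunOn w n m (glue k ρ ρ') :=
  (h.congr (fun _ _ => rfl) fun _ hi => (glue_of_le ρ ρ' hi.2).symm).trans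
    (h'.congr (fun _ _ => rfl) fun _ hi => (glue_of_ge hk hi.1).symm)

/-- The profile on `[n, m)` depends only on the letters before position `m`. -/
theorem profile_congr (Au : GBA Al Q) {w w' : ℕ → Al} {n m : ℕ} (hw : ∀ i < m, w i = w' i) :
    Au.profile w n m = Au.profile w' n m := by
  have key : ∀ {w w' : ℕ → Al}, (∀ i < m, w i = w' i) →
      Au.profile w n m ⊆ Au.profile w' n m := by
    rintro w w' hw _ ⟨ρ, hρ, rfl⟩
    refine ⟨ρ, hρ.congr (fun i hi => hw i hi.2) fun _ _ => rfl, ?_⟩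
    rw [transOn_congr (fun i hi => hw i hi.2) fun _ _ => rfl]
  exact (key hw).antisymm (key fun i hi => (hw i hi).symm)

/-- Equality of profiles ending at `k` propagates to later end points. -/
theorem profile_eq_of_le (Au : GBA Al Q) {w : ℕ → Al} {n n' k m : ℕ} (hn : n ≤ k) (hn' : n' ≤ k)
    (hkm : k ≤ m) (h : Au.profile w n k = Au.profile w n' k) :
    Au.profile w n m = Au.profile w n' m := by
  have key : ∀ {n n' : ℕ}, n ≤ k → n' ≤ k → Au.profile w n k = Au.profile w n' k →
      Au.profile w n m ⊆ Au.profile w n' m := by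
    rintro n n' hn hn' h _ ⟨ρ, hρ, rfl⟩
    have hmem : (ρ n, transOn w n k ρ, ρ k) ∈ Au.profile w n' k :=
      h ▸ ⟨ρ, fun i hi => hρ i ⟨hi.1, hi.2.trans_le hkm⟩, rfl⟩
    obtain ⟨σ, hσ, heq⟩ := hmem
    simp only [Prod.mk.injEq] at heq
    obtain ⟨hstart, htrans, hend⟩ := heq
    refine ⟨GBA.glue k σ ρ,
      hσ.glue (fun i hi => hρ i ⟨hn.trans hi.1, hi.2⟩) hend, ?_⟩
    have hleft : transOn w n' k (GBA.glue k σ ρ) = transOn w n' k σ :=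
      transOn_congr (fun _ _ => rfl) fun _ hi => glue_of_le σ ρ hi.2
    have hright : transOn w k m (GBA.glue k σ ρ) = transOn w k m ρ :=
      transOn_congr (fun _ _ => rfl) fun _ hi => glue_of_ge hend hi.1
    rw [← transOn_union w hn' hkm, hleft, hright, htrans, transOn_union w hn hkm,
      glue_of_le σ ρ hn', glue_of_ge hend hkm, hstart]
  exact (key hn hn' h).antisymm (key hn' hn h.symm)

/-- Some run fragment over `w` on `[n, m)` loops at `p` and meets every accepting set. -/
def HasAcceptingLoop (Au : GBA Al Q) (w : ℕ → Al) (p : Q) (n m : ℕ) : Prop :=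
  ∃ B, (p, B, p) ∈ Au.profile w n m ∧ ∀ F ∈ Au.acc, (B ∩ F).Nonempty

/-- Position `n` can be reached in state `p`, and infinitely many `m` admit an accepting loop
on `[n, m)` and have eventually the same profiles as `n`. -/
def IsRecurrent (Au : GBA Al Q) (w : ℕ → Al) (n : ℕ) (p : Q) : Prop :=
  (∃ q ∈ Au.init, ∃ B, (q, B, p) ∈ Au.profile w 0 n) ∧
    ∃ᶠ m in Filter.atTop, Au.HasAcceptingLoop w p n m ∧
      ∃ k ≥ m, Au.profile w n k = Au.profile w m k

/-- An accepting run yields a recurrent position. -/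
theorem IsAcceptingRun.exists_isRecurrent [Finite Al] [Finite Q] {Au : GBA Al Q} {w : ℕ → Al}
    {ρ : ℕ → Q} (h : Au.IsAcceptingRun w ρ) : ∃ n p, Au.IsRecurrent w n p := by
  obtain ⟨⟨hinit, hstep⟩, hacc⟩ := h
  obtain ⟨n, hn⟩ := exists_frequently_eq_of_finite (Au.profile w) ρ
  refine ⟨n, ρ n, ⟨ρ 0, hinit, _, ρ, fun i _ => hstep i, rfl⟩, ?_⟩
  have hvisit : ∀ᶠ m in Filter.atTop, ∀ F ∈ Au.acc, (transOn w n m ρ ∩ F).Nonempty := by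
    rw [Filter.eventually_all_finite Au.acc.toFinite]
    intro F hF
    obtain ⟨i, hiF, hni⟩ := (hacc F hF).exists_gt n
    filter_upwards [Filter.eventually_gt_atTop i] with m hm
    exact ⟨_, ⟨i, ⟨hni.le, hm⟩, rfl⟩, hiF⟩
  refine (hn.and_eventually hvisit).mono fun m hm => ?_
  exact ⟨⟨transOn w n m ρ, ⟨ρ, fun i _ => hstep i, by rw [hm.1.1]⟩, hm.2⟩, hm.1.2⟩

/-- A recurrent position yields an accepting run. -/
theorem IsRecurrent.mem_lang {Au : GBA Al Q} {w : ℕ → Al} {n : ℕ} {p : Q}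
    (h : Au.IsRecurrent w n p) : w ∈ Au.Lang := by
  obtain ⟨⟨q, hq, B₀, ρ₀, hρ₀, heq₀⟩, hfreq⟩ := h
  simp only [Prod.mk.injEq] at heq₀
  let St := {x : (ℕ → Q) × ℕ // x.1 0 ∈ Au.init ∧ Au.IsRunOn w 0 x.2 x.1 ∧ x.1 x.2 = p ∧
    ∃ k ≥ x.2, n ≤ k ∧ Au.profile w n k = Au.profile w x.2 k}
  have hnext : ∀ x : St, ∃ y : St, x.1.2 < y.1.2 ∧ (∀ i ≤ x.1.2, y.1.1 i = x.1.1 i) ∧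
      ∀ F ∈ Au.acc, (transOn w x.1.2 y.1.2 y.1.1 ∩ F).Nonempty := by
    rintro ⟨⟨σ, m⟩, hinit, hrun, hp, k, hmk, hnk, hprof⟩
    dsimp only at hinit hrun hp hmk hprof ⊢
    obtain ⟨m', hkm', ⟨B, hB, hBacc⟩, k', hmk', hprof'⟩ :=
      Filter.frequently_atTop.1 hfreq (k + 1)
    rw [Au.profile_eq_of_le hnk hmk (by omega) hprof] at hB
    obtain ⟨τ, hτ, heq⟩ := hB
    simp only [Prod.mk.injEq] at heq
    obtain ⟨hstart, rfl, hend⟩ := heq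
    have hm : σ m = τ m := hp.trans hstart.symm
    refine ⟨⟨(glue m σ τ, m'), ?_, hrun.glue hτ hm, ?_, k', hmk', by omega, hprof'⟩,
      by dsimp only; omega, fun i hi => glue_of_le σ τ hi, fun F hF => ?_⟩
    · dsimp only
      rwa [glue_of_le σ τ m.zero_le]
    · dsimp only
      rwa [glue_of_ge hm (by omega)]
    · dsimp only
      rw [transOn_congr (ρ' := τ) (fun _ _ => rfl) fun i hi => glue_of_ge hm hi.1]
      exact hBacc F hF
  choose next hlt hagree hvisit using hnext
  let x₀ : St := ⟨(ρ₀, n), by dsimp only; rwa [heq₀.1], hρ₀, heq₀.2.2, n, le_rfl, le_rfl, rfl⟩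
  let x : ℕ → St := fun a => next^[a] x₀
  have hx : ∀ a, x (a + 1) = next (x a) := fun a => Function.iterate_succ_apply' next a x₀
  have hmono : StrictMono fun a => (x a).1.2 :=
    strictMono_nat_of_lt_succ fun a => by rw [hx]; exact hlt _
  have hstable : ∀ {a b i : ℕ}, a ≤ b → i ≤ (x a).1.2 → (x b).1.1 i = (x a).1.1 i := by
    intro a b i hab hi
    induction b, hab using Nat.le_induction with
    | base => rfl
    | succ b hab ih => rw [hx, hagree _ _ (hi.trans (hmono.monotone hab)), ih]
  let ρ : ℕ → Q := fun i => (x i).1.1 i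
  have hρ : ∀ {a i : ℕ}, i ≤ (x a).1.2 → (x a).1.1 i = ρ i := by
    intro a i hi
    rcases le_total a i with hai | hia
    · exact (hstable hai hi).symm
    · exact hstable hia (hmono.id_le i)
  refine ⟨ρ, ⟨(x 0).2.1, fun i => ?_⟩, fun F hF => ?_⟩
  · exact ((x (i + 1)).2.2.1.congr (fun _ _ => rfl) fun j hj => hρ hj.2) i
      ⟨i.zero_le, hmono.id_le (i + 1)⟩
  · rw [← Nat.frequently_atTop_iff_infinite, Filter.frequently_atTop]
    intro a
    obtain ⟨_, ⟨i, hi, rfl⟩, hiF⟩ := hvisit (x a) F hF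
    rw [← hx] at hi hiF
    refine ⟨i, (hmono.id_le a).trans hi.1, ?_⟩
    dsimp only at hiF
    rwa [hρ hi.2.le, hρ hi.2] at hiF

theorem mem_lang_iff_exists_isRecurrent [Finite Al] [Finite Q] (Au : GBA Al Q) (w : ℕ → Al) :
    w ∈ Au.Lang ↔ ∃ n p, Au.IsRecurrent w n p :=
  ⟨fun ⟨_, hρ⟩ => hρ.exists_isRecurrent, fun ⟨_, _, h⟩ => h.mem_lang⟩

end GBA

/-- A predicate that depends only on the first `N` coordinates is measurable with respect to
the σ-algebra generated by the cylinder sets. -/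
theorem CylSigma.measurable_of_forall_lt {S : Type} [Countable S] {P : (ℕ → S) → Prop} (N : ℕ)
    (hP : ∀ π π' : ℕ → S, (∀ i < N, π i = π' i) → P π → P π') :
    @Measurable _ _ (CylSigma S) _ P := by
  let cyl : List S → Set (ℕ → S) := fun l => {π | ∀ i : Fin l.length, π i.1 = l.get i}
  have hunion : {π | P π} = ⋃ l ∈ {l | cyl l ⊆ {π | P π}}, cyl l := by
    refine subset_antisymm (fun π hπ => ?_) (Set.iUnion₂_subset fun _ hl => hl)
    refine Set.mem_iUnion₂.2 ⟨List.ofFn fun i : Fin N => π i, fun π' hπ' => ?_, fun i => by simp⟩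
    exact hP π π' (fun i hi => by simpa using (hπ' ⟨i, by simpa using hi⟩).symm) hπ
  let _ := CylSigma S
  rw [← measurableSet_setOfPred, hunion]
  exact MeasurableSet.biUnion (Set.to_countable _) fun l _ =>
    MeasurableSpace.measurableSet_generateFrom ⟨l, rfl⟩

/-- A property of two profiles of the word of a path is measurable. -/
theorem MC.measurable_profile {S Al Q : Type} [Countable S] (M : MC S Al) (Au : GBA Al Q)
    (n m n' m' : ℕ)
    (R : Set (Q × Set (Q × Al × Q) × Q) → Set (Q × Set (Q × Al × Q) × Q) → Prop) :
    @Measurable _ _ (CylSigma S) _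
      fun π => R (Au.profile (M.word π) n m) (Au.profile (M.word π) n' m') := by
  refine CylSigma.measurable_of_forall_lt (max m m') fun π π' h hR => ?_
  have hword : ∀ i < max m m', M.word π i = M.word π' i := fun i hi => congrArg M.L (h i hi)
  rwa [← Au.profile_congr fun i hi => hword i (lt_max_of_lt_left hi),
    ← Au.profile_congr fun i hi => hword i (lt_max_of_lt_right hi)]

/-- For every finite Markov chain `M` with labelling `L : S → Σ` and
every generalized Büchi automaton `A` over the finite alphabet `Σ`, the set
`{π ∈ S^ω : L ∘ π ∈ L(A)}` is measurable with respect to the σ-algebra on `S^ω`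
generated by the cylinder sets. -/
theorem gba_lang_measurable {S Al Q : Type} [Fintype S] [Fintype Al] [Fintype Q]
    (M : MC S Al) (hM : ∀ s : S, ∑ t : S, M.P s t = 1)
    (Au : GBA Al Q) :
    @MeasurableSet (ℕ → S) (CylSigma S) {π : ℕ → S | M.word π ∈ Au.Lang} := by
  simp only [GBA.mem_lang_iff_exists_isRecurrent, GBA.IsRecurrent, Filter.frequently_atTop]
  let _ := CylSigma S
  refine measurableSet_setOfPred.2 (.exists fun n => .exists fun p => .and ?_ (.forall fun a =>
    .exists fun m => .and measurable_const (.and ?_ (.exists fun k => .and measurable_const ?_))))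
  · exact M.measurable_profile Au 0 n 0 n fun X _ => ∃ q ∈ Au.init, ∃ B, (q, B, p) ∈ X
  · exact M.measurable_profile Au n m n m fun X _ =>
      ∃ B, (p, B, p) ∈ X ∧ ∀ F ∈ Au.acc, (B ∩ F).Nonempty
  · exact M.measurable_profile Au n k m k Eq
end

section
/- Let A be a reverse deterministic generalized Büchi automaton, M a finite Markov chain, G = A × M their product graph, C a complete SCC of G, and K = H(C). Let σ_C be an infinite path all of whose vertices are in C and let σ_K = proj(σ_C). Then σ_C visits every finite path of C infinitely often if and only if σ_K visits every finite path of K infinitely often, where an infinite path visits a finite path ρ infinitely often if ρ occurs as a contiguous fragment starting at infinitely many positions of the infinite path. -/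
open scoped ENNReal

/-- A vertex lying on a path between two vertices of a strongly connected component
belongs to that component. -/
theorem IsSCC.mem_of_reachable {V : Type} {E : V → V → Prop} {C : Set V} (hC : IsSCC E C)
    {u w v : V} (hu : u ∈ C) (hv : v ∈ C) (huw : Relation.ReflTransGen E u w)
    (hwv : Relation.ReflTransGen E w v) : w ∈ C := by
  have hins : insert w C = C := by
    refine hC.2.2 _ (Set.subset_insert w C) ?_
    rintro a (rfl | ha) b (rfl | hb)
    · exact .refl
    · exact hwv.trans (hC.2.1 v hv b hb)
    · exact (hC.2.1 a ha u hu).trans huw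
    · exact hC.2.1 a ha b hb
  exact hins ▸ Set.mem_insert w C

/-- A nonempty path of a strongly connected component can be extended to the left, inside
the component, so as to begin at any prescribed vertex. -/
theorem IsSCC.exists_cons_path {V : Type} {E : V → V → Prop} {C : Set V} (hC : IsSCC E C)
    {u v : V} {σ : List V} (hσ : FinPathIn E C (v :: σ)) (hu : u ∈ C) :
    ∃ τ : List V, FinPathIn E C (u :: τ) ∧ (v :: σ) <:+ (u :: τ) := by
  have hv : v ∈ C := hσ.2 v List.mem_cons_self
  have huv := hC.2.1 u hu v hv
  induction huv using Relation.ReflTransGen.head_induction_on with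
  | refl => exact ⟨σ, hσ, List.suffix_refl _⟩
  | @head u w huw hwv ih =>
    obtain ⟨τ, hτ, hsuf⟩ := ih (hC.mem_of_reachable hu hv (.single huw) hwv)
    exact ⟨w :: τ, ⟨List.isChain_cons_cons.2 ⟨huw, hτ.1⟩, List.forall_mem_cons.2 ⟨hu, hτ.2⟩⟩,
      hsuf.trans (List.suffix_cons _ _)⟩

/-- A nonempty path `σ` of a strongly connected component can be extended to the left, inside
the component, to a path that contains a prescribed path `ρ`. -/
theorem IsSCC.exists_path_infix_suffix {V : Type} {E : V → V → Prop} {C : Set V}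
    (hC : IsSCC E C) {ρ σ : List V} (hρ : FinPathIn E C ρ) (hσ : FinPathIn E C σ)
    (hne : σ ≠ []) : ∃ τ : List V, FinPathIn E C τ ∧ ρ <:+: τ ∧ σ <:+ τ := by
  rcases List.eq_nil_or_concat' ρ with rfl | ⟨ρ', u, rfl⟩
  · exact ⟨σ, hσ, List.nil_infix, List.suffix_refl σ⟩
  obtain ⟨v, σ', rfl⟩ := List.exists_cons_of_ne_nil hne
  obtain ⟨τ, hτ, hsuf⟩ := hC.exists_cons_path hσ (hρ.2 u (by simp))
  refine ⟨ρ' ++ u :: τ, ⟨List.isChain_split.2 ⟨hρ.1, hτ.1⟩, ?_⟩, ⟨[], τ, by simp⟩,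
    hsuf.trans (List.suffix_append _ _)⟩
  intro x hx
  rcases List.mem_append.1 hx with hx | hx
  · exact hρ.2 x (by simp [hx])
  · exact hτ.2 x hx

section VisitsInfOften

variable {V W : Type} {π : ℕ → V}

/-- Visiting a list infinitely often, in terms of fragments of the sequence. -/
theorem visitsInfOften_iff {l : List V} :
    VisitsInfOften π l ↔
      {n : ℕ | (List.range l.length).map (fun i => π (n + i)) = l}.Infinite := by
  have h (n : ℕ) : (∀ i : Fin l.length, π (n + i.1) = l.get i) ↔
      (List.range l.length).map (fun i => π (n + i)) = l := by
    constructor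
    · intro h
      refine List.ext_getElem (by simp) fun i hi hi' => ?_
      simpa using h ⟨i, hi'⟩
    · intro h i
      have := List.getElem_of_eq h (i := i.1) (by simp)
      simpa using this
  simp only [VisitsInfOften, h]

theorem VisitsInfOften.map {l : List V} (f : V → W) (h : VisitsInfOften π l) :
    VisitsInfOften (fun i => f (π i)) (l.map f) := by
  refine h.mono fun n hn i => ?_
  have := hn ⟨i.1, by simpa using i.2⟩
  simpa using congrArg f this

/-- If, infinitely often, the fragment of length `k` of `π` contains `ρ`, then `π` visits `ρ`
infinitely often. -/
theorem visitsInfOften_of_infinite_infix {ρ : List V} {k : ℕ}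
    (h : {n : ℕ | ρ <:+: (List.range k).map (fun i => π (n + i))}.Infinite) :
    VisitsInfOften π ρ := by
  refine Set.infinite_of_forall_exists_gt fun a => ?_
  obtain ⟨n, ⟨x, y, hxy⟩, hn⟩ := h.exists_gt a
  refine ⟨n + x.length, fun i => ?_, by omega⟩
  have hlt : x.length + i.1 < (x ++ ρ ++ y).length := by
    have := i.2
    simp only [List.length_append]
    omega
  have := List.getElem_of_eq hxy hlt
  rw [List.getElem_append_left (by simp), List.getElem_append_right (by simp)] at this
  simpa [add_assoc] using this.symm

end VisitsInfOften

/-- The fragments of an infinite path are finite paths. -/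
theorem InfPathIn.finPathIn_map_range {V : Type} {E : V → V → Prop} {C : Set V} {π : ℕ → V}
    (h : InfPathIn E C π) (n k : ℕ) :
    FinPathIn E C ((List.range k).map (fun i => π (n + i))) := by
  constructor
  · refine List.isChain_iff_getElem.2 fun i hi => ?_
    simpa [add_assoc] using h.1 (n + i)
  · intro v hv
    obtain ⟨i, -, rfl⟩ := List.mem_map.1 hv
    exact h.2 _

section Product

variable {S Al Q : Type} {Au : GBA Al Q} {M : MC S Al} {C : Set (Q × S)}

/-- Paths of the product graph project to paths of the Markov chain. -/
theorem FinPathIn.map_snd {σ : List (Q × S)} (hσ : FinPathIn (prodE Au M) C σ) :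
    FinPathIn M.E (Hproj C) (σ.map Prod.snd) := by
  constructor
  · exact (List.isChain_map Prod.snd).2 (List.IsChain.imp (fun _ _ h => h.1) hσ.1)
  · intro s hs
    obtain ⟨v, hv, rfl⟩ := List.mem_map.1 hs
    exact ⟨v, hσ.2 v hv, rfl⟩

/-- In a reverse deterministic product, a path is determined by its projection and its last
vertex. -/
theorem GBA.RevDet.path_unique (hrev : Au.RevDet) :
    ∀ {σ τ : List (Q × S)}, σ.IsChain (prodE Au M) → τ.IsChain (prodE Au M) →
      σ.map Prod.snd = τ.map Prod.snd → σ.getLast? = τ.getLast? → σ = τ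
  | [], τ, _, _, hmap, _ => by simpa using hmap.symm
  | [a], τ, _, _, hmap, hlast => by
    obtain ⟨b, rfl⟩ : ∃ b, τ = [b] := List.length_eq_one_iff.1 (by
      simpa using (congrArg List.length hmap).symm)
    simpa using hlast
  | a :: a' :: σ, [], _, _, hmap, _ => by simp at hmap
  | a :: a' :: σ, [b], _, _, hmap, _ => by simp at hmap
  | a :: a' :: σ, b :: b' :: τ, hσ, hτ, hmap, hlast => by
    rw [List.isChain_cons_cons] at hσ hτ
    rw [List.map_cons, List.map_cons (l := b' :: τ), List.cons.injEq] at hmap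
    rw [List.getLast?_cons_cons, List.getLast?_cons_cons] at hlast
    have htail := hrev.path_unique hσ.2 hτ.2 hmap.2 hlast
    obtain ⟨rfl, -⟩ := List.cons.inj htail
    have hab : a = b :=
      Prod.ext ((hrev a'.1 (M.L a.2)).unique hσ.1.2 (hmap.1 ▸ hτ.1.2)) hmap.1
    rw [hab, htail]

/-- The last vertices of those lifts of `l` to `C` that do not contain `ρ`. -/
def avoidingEnds (Au : GBA Al Q) (M : MC S Al) (C : Set (Q × S)) (ρ : List (Q × S))
    (l : List S) : Set (Q × S) :=
  {v | ∃ σ, FinPathIn (prodE Au M) C σ ∧ σ.map Prod.snd = l ∧ σ.getLast? = some v ∧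
    ¬ ρ <:+: σ}

/-- Extending a path to the left shrinks the set of ends of its lifts that avoid `ρ`. -/
theorem avoidingEnds_mono {ρ : List (Q × S)} {l l' : List S} (hne : l ≠ []) (h : l <:+ l') :
    avoidingEnds Au M C ρ l' ⊆ avoidingEnds Au M C ρ l := by
  obtain ⟨x, rfl⟩ := h
  rintro v ⟨σ, hσ, hmap, hlast, hρ⟩
  obtain ⟨σ₁, σ₂, rfl, -, rfl⟩ := List.map_eq_append_iff.1 hmap
  have hsuf : σ₂ <:+ σ₁ ++ σ₂ := List.suffix_append _ _
  refine ⟨σ₂, ⟨List.IsChain.suffix hσ.1 hsuf, fun v hv => hσ.2 v (hsuf.mem hv)⟩, rfl, ?_,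
    fun h => hρ (h.trans hsuf.isInfix)⟩
  rwa [List.getLast?_append_of_ne_nil _ (by simpa using hne)] at hlast

/-- Every path of `C` is contained in all lifts to `C` of a suitable path of `H(C)`. -/
theorem exists_path_forall_lift_infix [Finite S] [Finite Q] (hrev : Au.RevDet)
    (hC : IsSCC (prodE Au M) C) {ρ : List (Q × S)} (hρ : FinPathIn (prodE Au M) C ρ) :
    ∃ l : List S, FinPathIn M.E (Hproj C) l ∧
      ∀ σ, FinPathIn (prodE Au M) C σ → σ.map Prod.snd = l → ρ <:+: σ := by
  suffices h : ∀ (n : ℕ) (l : List S), l ≠ [] → FinPathIn M.E (Hproj C) l →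
      (avoidingEnds Au M C ρ l).ncard = n →
      ∃ l : List S, FinPathIn M.E (Hproj C) l ∧
        ∀ σ, FinPathIn (prodE Au M) C σ → σ.map Prod.snd = l → ρ <:+: σ by
    obtain ⟨v, hv⟩ := hC.1
    exact h _ [v.2] (by simp) ⟨List.isChain_singleton _, by simpa using ⟨v, hv, rfl⟩⟩ rfl
  intro n
  induction n using Nat.strong_induction_on with
  | _ n ih =>
  rintro l hne hl rfl
  by_cases hbad : ∃ σ, FinPathIn (prodE Au M) C σ ∧ σ.map Prod.snd = l ∧ ¬ ρ <:+: σ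
  · obtain ⟨σ, hσ, rfl, hρσ⟩ := hbad
    have hσne : σ ≠ [] := by simpa using hne
    obtain ⟨τ, hτ, hρτ, hsuf⟩ := hC.exists_path_infix_suffix hρ hσ hσne
    have hτlast : τ.getLast? = some (σ.getLast hσne) := by
      obtain ⟨x, rfl⟩ := hsuf
      rw [List.getLast?_append_of_ne_nil _ hσne, List.getLast?_eq_getLast_of_ne_nil hσne]
    have hτne : τ.map Prod.snd ≠ [] := by
      rintro h
      simp [List.map_eq_nil_iff.1 h] at hτlast
    refine ih _ (Set.ncard_lt_ncard ?_) (τ.map Prod.snd) hτne hτ.map_snd rfl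
    refine (Set.ssubset_iff_of_subset (avoidingEnds_mono hne (hsuf.map Prod.snd))).2
      ⟨σ.getLast hσne, ⟨σ, hσ, rfl, List.getLast?_eq_getLast_of_ne_nil hσne, hρσ⟩, ?_⟩
    rintro ⟨τ', hτ', hmap, hlast, hρτ'⟩
    exact hρτ' (hrev.path_unique hτ'.1 hτ.1 hmap (hlast.trans hτlast.symm) ▸ hρτ)
  · push Not at hbad
    exact ⟨l, hl, hbad⟩

end Product

/-- Let `C` be a complete SCC of the product graph `G = A × M` of a
reverse deterministic GBA `A` and a finite Markov chain `M`, and `K = H(C)`.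
Let `σ_C` be an infinite path all of whose vertices are in `C` and
`σ_K = proj σ_C`. Then `σ_C` visits every finite path of `C` infinitely often
iff `σ_K` visits every finite path of `K` infinitely often. -/
theorem complete_scc_visits_iff {S Al Q : Type}
    [Fintype S] [Fintype Al] [Fintype Q]
    (Au : GBA Al Q) (M : MC S Al)
    (hM : ∀ s : S, ∑ t : S, M.P s t = 1)
    (hrev : Au.RevDet)
    (C : Set (Q × S)) (hC : IsSCC (prodE Au M) C)
    (hcomp : CompleteSCC Au M C)
    (σC : ℕ → Q × S) (hσ : InfPathIn (prodE Au M) C σC) :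
    (∀ l : List (Q × S), FinPathIn (prodE Au M) C l → VisitsInfOften σC l) ↔
    (∀ l : List S, FinPathIn M.E (Hproj C) l →
      VisitsInfOften (fun i => (σC i).2) l) := by
  constructor
  · intro h l hl
    obtain ⟨σ, hσl, rfl⟩ := hcomp l hl
    exact (h σ hσl).map Prod.snd
  · intro h ρ hρ
    obtain ⟨l, hl, hlift⟩ := exists_path_forall_lift_infix hrev hC hρ
    refine visitsInfOften_of_infinite_infix (k := l.length)
      ((visitsInfOften_iff.1 (h l hl)).mono fun n hn => ?_)
    refine hlift _ (hσ.finPathIn_map_range n l.length) ?_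
    rwa [List.map_map]
end

section
/- Let M = (S, L, s̄, P) be a finite Markov chain and let C be a bottom SCC of its underlying graph (ergodicity property): for every state s ∈ C and every finite path ρ lying entirely within C, the set of infinite paths starting at s that visit ρ infinitely often (i.e., ρ occurs as a contiguous fragment starting at infinitely many positions) has probability 1 under the path measure of M with initial state s. -/
open scoped ENNReal

theorem IsBSCC.mem_of_reach {V : Type} {E : V → V → Prop} {C : Set V} (hC : IsBSCC E C)
    {u v : V} (hu : u ∈ C) (h : Relation.ReflTransGen E u v) : v ∈ C := by
  have hscc : IsSCC E {x | Relation.ReflTransGen E v x ∧ Relation.ReflTransGen E x v} := by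
    refine ⟨⟨v, .refl, .refl⟩, fun x hx y hy => hx.2.trans hy.1, fun C' hsub hC' => ?_⟩
    refine Set.Subset.antisymm (fun x hx => ?_) hsub
    have hv : v ∈ C' := hsub ⟨.refl, .refl⟩
    exact ⟨hC' v hv x hx, hC' x hx v hv⟩
  have heq := hC.2 _ hscc ⟨u, hu, v, ⟨.refl, .refl⟩, h⟩
  rw [← heq]
  exact ⟨.refl, .refl⟩

/-- The word `l` occurs in `π` at position `n`. -/
def OccursAt {V : Type} (l : List V) (π : ℕ → V) (n : ℕ) : Prop :=
  ∀ i : Fin l.length, π (n + i.1) = l.get i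

theorem OccursAt.congr {V : Type} {l : List V} {π π' : ℕ → V} {n K : ℕ}
    (h : OccursAt l π n) (hn : n + l.length ≤ K + 1) (hπ : ∀ i ≤ K, π' i = π i) :
    OccursAt l π' n := by
  intro i
  have := i.2
  rw [hπ _ (by omega), h i]

/-- From every vertex of a strongly connected set, some finite walk contains a given path. -/
theorem exists_walk_occursAt {V : Type} {E : V → V → Prop} {C : Set V} (hC : MutReach E C)
    {l : List V} (hl : FinPathIn E C l) {u : V} (hu : u ∈ C) :
    ∃ (N : ℕ) (g : ℕ → V) (n : ℕ), g 0 = u ∧ (∀ i < N, E (g i) (g (i + 1))) ∧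
      n + l.length ≤ N + 1 ∧ OccursAt l g n := by
  obtain ⟨hchain, hmem⟩ := hl
  cases l with
  | nil => exact ⟨0, fun _ => u, 0, rfl, by simp, by simp, fun i => i.elim0⟩
  | cons a l =>
    have hreach := hC u hu a (hmem a (by simp))
    clear hu
    induction hreach using Relation.ReflTransGen.head_induction_on with
    | refl =>
      refine ⟨l.length, fun i => (a :: l).getD i a, 0, by simp, fun i hi => ?_, by simp,
        fun i => ?_⟩
      · have h := List.isChain_iff_getElem.1 hchain i (by simpa using hi)
        beta_reduce
        rw [List.getD_eq_getElem _ _ (by simp; omega), List.getD_eq_getElem _ _ (by simpa using hi)]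
        exact h
      · simp only [zero_add]
        rw [List.getD_eq_getElem _ _ i.2]
        rfl
    | @head x _ huv _ ih =>
      obtain ⟨N, g, n, hg0, hg, hn, hocc⟩ := ih
      refine ⟨N + 1, fun i => Nat.casesOn i x g, n + 1, rfl, fun i hi => ?_, by omega,
        fun i => ?_⟩
      · cases i with
        | zero => simpa [hg0] using huv
        | succ i => exact hg i (by omega)
      · have := hocc i
        rw [show n + 1 + i.1 = (n + i.1) + 1 by omega]
        exact this

theorem measurableSet_coord_eq {S : Type} [Countable S] (i : ℕ) (x : S) :
    @MeasurableSet _ (CylSigma S) {π : ℕ → S | π i = x} := by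
  let _ := CylSigma S
  have h : {π : ℕ → S | π i = x} = ⋃ l ∈ {l : List S | l[i]? = some x},
      {π : ℕ → S | ∀ j : Fin l.length, π j.1 = l.get j} := by
    ext π
    simp only [Set.mem_ofPred_eq, Set.mem_iUnion, exists_prop]
    constructor
    · rintro rfl
      refine ⟨List.ofFn (fun j : Fin (i + 1) => π j), ?_, fun j => ?_⟩
      · rw [List.getElem?_ofFn, dif_pos (Nat.lt_succ_self i)]
      · rw [List.get_ofFn]
        rfl
    · rintro ⟨l, hl, hπ⟩
      obtain ⟨hi, hx⟩ := List.getElem?_eq_some_iff.1 hl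
      rw [← hx]
      exact hπ ⟨i, hi⟩
  rw [h]
  exact MeasurableSet.biUnion (Set.to_countable _)
    fun l _ => MeasurableSpace.measurableSet_generateFrom ⟨l, rfl⟩

theorem measurableSet_occursAt {S : Type} [Countable S] (l : List S) (n : ℕ) :
    @MeasurableSet _ (CylSigma S) {π : ℕ → S | OccursAt l π n} := by
  let _ := CylSigma S
  simp only [OccursAt, Set.ofPred_forall]
  exact MeasurableSet.iInter fun i => measurableSet_coord_eq _ _

/-- If every nonnull cylinder of length `K + 1` meets `B` with conditional probability at least
`ε`, then so does every event determined by the coordinates up to `K`. -/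
theorem measure_diff_le_of_cylinders {S : Type} [Finite S]
    (μ : @MeasureTheory.Measure (ℕ → S) (CylSigma S))
    (hfin : μ Set.univ ≠ ⊤) (K : ℕ) (ε : ℝ≥0∞)
    (D B : Set (ℕ → S)) (hB : @MeasurableSet _ (CylSigma S) B)
    (hD : ∀ π π' : ℕ → S, (∀ i ≤ K, π' i = π i) → π ∈ D → π' ∈ D)
    (h : ∀ f : ℕ → S, ε * μ {π | ∀ i ≤ K, π i = f i} ≤ μ ({π | ∀ i ≤ K, π i = f i} ∩ B)) :
    μ (D \ B) ≤ (1 - ε) * μ D := by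
  classical
  let _ := CylSigma S
  have : Fintype (Fin (K + 1) → S) := Fintype.ofFinite _
  let r : (ℕ → S) → (Fin (K + 1) → S) := fun π j => π j
  have hr : ∀ π : ℕ → S, r ⁻¹' {r π} = {π' | ∀ i ≤ K, π' i = π i} := by
    intro π
    ext π'
    simp only [Set.mem_preimage, Set.mem_singleton_iff, Set.mem_ofPred_eq, r, funext_iff]
    exact ⟨fun h i hi => h ⟨i, by omega⟩, fun h j => h j (by omega)⟩
  let W : Finset (Fin (K + 1) → S) := Finset.univ.filter fun w => w ∈ r '' D
  have hmeas : ∀ w, MeasurableSet (r ⁻¹' {w}) := by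
    intro w
    have : r ⁻¹' {w} = ⋂ j, {π | π j.1 = w j} := by
      ext π
      simp [r, funext_iff]
    rw [this]
    exact MeasurableSet.iInter fun j => measurableSet_coord_eq _ _
  have hDW : r ⁻¹' (W : Set _) = D := by
    ext π
    simp only [W, Finset.coe_filter, Finset.mem_univ, true_and, Set.mem_preimage,
      Set.mem_ofPred_eq]
    constructor
    · rintro ⟨π', hπ', he⟩
      have : π ∈ r ⁻¹' {r π'} := he.symm
      rw [hr] at this
      exact hD π' π this hπ'
    · exact fun hπ => ⟨π, hπ, rfl⟩
  have hsum : ∑ w ∈ W, μ (r ⁻¹' {w}) = μ D := by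
    rw [MeasureTheory.sum_measure_preimage_singleton W fun w _ => hmeas w, hDW]
  have hcell : ∀ w ∈ W, μ (r ⁻¹' {w} \ B) ≤ (1 - ε) * μ (r ⁻¹' {w}) := by
    intro w hw
    obtain ⟨π, -, rfl⟩ := (Finset.mem_filter.1 hw).2
    rw [hr]
    have hne : ∀ X, μ X ≠ ⊤ := fun X =>
      MeasureTheory.measure_ne_top_of_subset (Set.subset_univ X) hfin
    rw [ENNReal.sub_mul (fun _ _ => hne _), one_mul]
    refine le_trans ?_ (tsub_le_tsub_left (h π) _)
    refine ENNReal.le_sub_of_add_le_left (hne _) ?_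
    rw [MeasureTheory.measure_inter_add_sdiff _ hB]
  calc μ (D \ B) ≤ μ (⋃ w ∈ W, r ⁻¹' {w} \ B) := by
        refine MeasureTheory.measure_mono fun π hπ => ?_
        have : r π ∈ W := by
          have := hπ.1
          rw [← hDW] at this
          exact this
        exact Set.mem_biUnion this ⟨rfl, hπ.2⟩
    _ ≤ ∑ w ∈ W, μ (r ⁻¹' {w} \ B) := MeasureTheory.measure_biUnion_finset_le _ _
    _ ≤ ∑ w ∈ W, (1 - ε) * μ (r ⁻¹' {w}) := Finset.sum_le_sum hcell
    _ = (1 - ε) * μ D := by rw [← Finset.mul_sum, hsum]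

namespace IsPathMeasure

variable {S : Type} [DecidableEq S] {P : S → S → ℝ≥0∞} {s : S}
  {μ : @MeasureTheory.Measure (ℕ → S) (CylSigma S)}

theorem measure_start (hμ : IsPathMeasure P s μ) (x : S) :
    μ {π | π 0 = x} = if x = s then 1 else 0 := by
  simpa using hμ 0 fun _ => x

theorem measure_start_compl [Countable S] (hμ : IsPathMeasure P s μ) : μ {π | π 0 = s}ᶜ = 0 := by
  let _ := CylSigma S
  have h : {π : ℕ → S | π 0 = s}ᶜ = ⋃ x ∈ {x : S | x ≠ s}, {π | π 0 = x} := by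
    ext π
    simp
  rw [h, MeasureTheory.measure_biUnion_null_iff (Set.to_countable _)]
  intro x hx
  rw [hμ.measure_start, if_neg hx]

theorem measure_univ [Countable S] (hμ : IsPathMeasure P s μ) : μ Set.univ = 1 := by
  let _ := CylSigma S
  have h := MeasureTheory.measure_add_measure_compl (μ := μ) (measurableSet_coord_eq 0 s)
  rw [← h, hμ.measure_start_compl, hμ.measure_start, if_pos rfl, add_zero]

/-- The Markov property on cylinders: prolonging a cylinder by a word multiplies its measure by the
weight of this word. -/
theorem measure_cylinder_inter (hμ : IsPathMeasure P s μ) (K N : ℕ) (f g : ℕ → S)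
    (hg : g 0 = f K) :
    μ ({π | ∀ i ≤ K, π i = f i} ∩ {π | ∀ i ≤ N, π (K + i) = g i}) =
      μ {π | ∀ i ≤ K, π i = f i} * ∏ i ∈ Finset.range N, P (g i) (g (i + 1)) := by
  let F : ℕ → S := fun i => if i ≤ K then f i else g (i - K)
  have hFf : ∀ i ≤ K, F i = f i := fun i hi => if_pos hi
  have hFg : ∀ i, F (K + i) = g i := by
    intro i
    rcases Nat.eq_zero_or_pos i with rfl | hi
    · rw [add_zero, hFf K le_rfl, hg]
    · simp only [F]
      rw [if_neg (by omega), Nat.add_sub_cancel_left]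
  have hset : {π : ℕ → S | ∀ i ≤ K, π i = f i} ∩ {π | ∀ i ≤ N, π (K + i) = g i} =
      {π | ∀ i ≤ K + N, π i = F i} := by
    ext π
    simp only [Set.mem_inter_iff, Set.mem_ofPred_eq]
    constructor
    · rintro ⟨h1, h2⟩ i hi
      rcases le_total i K with hiK | hiK
      · rw [h1 i hiK, hFf i hiK]
      · obtain ⟨j, rfl⟩ := Nat.exists_eq_add_of_le hiK
        rw [h2 j (by omega), hFg]
    · intro h
      exact ⟨fun i hi => by rw [h i (by omega), hFf i hi],
        fun i hi => by rw [h _ (by omega), hFg]⟩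
  rw [hset, hμ, hμ, Finset.prod_range_add, hFf 0 (Nat.zero_le _), mul_assoc]
  congr 2
  · refine Finset.prod_congr rfl fun i hi => ?_
    have := Finset.mem_range.1 hi
    rw [hFf i (by omega), hFf (i + 1) (by omega)]
  · refine Finset.prod_congr rfl fun i _ => ?_
    rw [hFg, add_assoc, hFg]

/-- A nonnull cylinder of a path measure ends in a state reachable from the initial state. -/
theorem reach_of_measure_ne_zero (hμ : IsPathMeasure P s μ) {K : ℕ} {f : ℕ → S}
    (h : μ {π | ∀ i ≤ K, π i = f i} ≠ 0) :
    Relation.ReflTransGen (fun x y => 0 < P x y) s (f K) := by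
  rw [hμ K f, mul_ne_zero_iff, Finset.prod_ne_zero_iff] at h
  obtain ⟨h0, h⟩ := h
  have hs : f 0 = s := by
    by_contra hne
    exact h0 (if_neg hne)
  have key : ∀ j ≤ K, Relation.ReflTransGen (fun x y => 0 < P x y) s (f j) := by
    intro j
    induction j with
    | zero => intro _; rw [hs]
    | succ j ih =>
      intro hj
      exact (ih (by omega)).tail (pos_iff_ne_zero.2 (h j (Finset.mem_range.2 hj)))
  exact key K le_rfl

end IsPathMeasure

/-- A path measure started in a bottom SCC has, after any cylinder, a conditional probability
bounded below of seeing a given path within a bounded time. -/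
theorem exists_uniform_occursAt_bound {S Al : Type} [Fintype S] [DecidableEq S]
    (M : MC S Al) {C : Set S} (hC : IsBSCC M.E C) {s : S} (hs : s ∈ C)
    {l : List S} (hl : FinPathIn M.E C l)
    {μ : @MeasureTheory.Measure (ℕ → S) (CylSigma S)} (hμ : IsPathMeasure M.P s μ) :
    ∃ (N : ℕ) (ε : ℝ≥0∞), 0 < ε ∧ ∀ (K : ℕ) (f : ℕ → S),
      ε * μ {π | ∀ i ≤ K, π i = f i} ≤ μ ({π | ∀ i ≤ K, π i = f i} ∩
        {π | ∃ n, K ≤ n ∧ n + l.length ≤ K + N + 1 ∧ OccursAt l π n}) := by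
  let _ := CylSigma S
  have hwalk : ∀ u : S, ∃ (N : ℕ) (g : ℕ → S) (ε : ℝ≥0∞), 0 < ε ∧ (u ∈ C → g 0 = u ∧
      ε = ∏ i ∈ Finset.range N, M.P (g i) (g (i + 1)) ∧
      ∃ n, n + l.length ≤ N + 1 ∧ OccursAt l g n) := by
    intro u
    by_cases hu : u ∈ C
    · obtain ⟨N, g, n, hg0, hg, hn, hocc⟩ := exists_walk_occursAt hC.1.2.1 hl hu
      refine ⟨N, g, _, pos_iff_ne_zero.2 (Finset.prod_ne_zero_iff.2 fun i hi => ?_),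
        fun _ => ⟨hg0, rfl, n, hn, hocc⟩⟩
      exact (hg i (Finset.mem_range.1 hi)).ne'
    · exact ⟨0, fun _ => u, 1, one_pos, fun h => absurd h hu⟩
  choose N g ε hε hprop using hwalk
  refine ⟨Finset.univ.sup N, Finset.univ.inf ε,
    (Finset.lt_inf_iff ENNReal.zero_lt_top).2 fun u _ => hε u, fun K f => ?_⟩
  by_cases hnull : μ {π | ∀ i ≤ K, π i = f i} = 0
  · simp [hnull]
  have hfK : f K ∈ C := hC.mem_of_reach hs (hμ.reach_of_measure_ne_zero hnull)
  obtain ⟨hg0, hprod, n, hn, hocc⟩ := hprop _ hfK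
  have hN : N (f K) ≤ Finset.univ.sup N := Finset.le_sup (Finset.mem_univ _)
  calc Finset.univ.inf ε * μ {π | ∀ i ≤ K, π i = f i}
      ≤ ε (f K) * μ {π | ∀ i ≤ K, π i = f i} := by
        gcongr
        exact Finset.inf_le (Finset.mem_univ _)
    _ = μ ({π | ∀ i ≤ K, π i = f i} ∩ {π | ∀ i ≤ N (f K), π (K + i) = g (f K) i}) := by
        rw [hμ.measure_cylinder_inter K _ f _ hg0, mul_comm, hprod]
    _ ≤ _ := by
        refine MeasureTheory.measure_mono (Set.inter_subset_inter_right _ fun π hπ => ?_)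
        refine ⟨K + n, by omega, by omega, fun i => ?_⟩
        have := i.2
        rw [add_assoc, hπ _ (by omega), hocc i]

/-- Almost surely a given path of a bottom SCC occurs after any given time. -/
theorem measure_not_occursAt_eq_zero {S Al : Type} [Fintype S] [DecidableEq S]
    (M : MC S Al) {C : Set S} (hC : IsBSCC M.E C) {s : S} (hs : s ∈ C)
    {l : List S} (hl : FinPathIn M.E C l)
    {μ : @MeasureTheory.Measure (ℕ → S) (CylSigma S)} (hμ : IsPathMeasure M.P s μ) (k : ℕ) :
    μ {π | ∀ n, k ≤ n → ¬ OccursAt l π n} = 0 := by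
  let _ := CylSigma S
  obtain ⟨N, ε, hε, hbound⟩ := exists_uniform_occursAt_bound M hC hs hl hμ
  have huniv := hμ.measure_univ
  let D : ℕ → Set (ℕ → S) := fun m =>
    {π | ∀ n, k ≤ n → n + l.length ≤ k + m * N + 1 → ¬ OccursAt l π n}
  have hdecay : ∀ m, μ (D m) ≤ (1 - ε) ^ m := by
    intro m
    induction m with
    | zero =>
      rw [pow_zero, ← huniv]
      exact MeasureTheory.measure_mono (Set.subset_univ _)
    | succ m ih =>
      have hB : MeasurableSet {π : ℕ → S | ∃ n, k + m * N ≤ n ∧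
          n + l.length ≤ k + m * N + N + 1 ∧ OccursAt l π n} := by
        rw [Set.ofPred_exists]
        exact MeasurableSet.iUnion fun n => (MeasurableSet.const _).inter
          ((MeasurableSet.const _).inter (measurableSet_occursAt l n))
      refine le_trans (MeasureTheory.measure_mono ?_) ((measure_diff_le_of_cylinders μ
        (by simp [huniv]) (k + m * N) ε (D m) _ hB ?_ (hbound _)).trans ?_)
      · intro π hπ
        have hmul : (m + 1) * N = m * N + N := Nat.succ_mul m N
        refine ⟨fun n hkn hn => hπ n hkn (by omega), ?_⟩
        rintro ⟨n, hkn, hn, hocc⟩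
        exact hπ n (by omega) (by omega) hocc
      · intro π π' heq hπ n hkn hn hocc
        exact hπ n hkn hn (hocc.congr hn fun i hi => (heq i hi).symm)
      · rw [pow_succ']
        gcongr
  have hlim : Filter.Tendsto (fun m : ℕ => (1 - ε) ^ m) Filter.atTop (nhds 0) :=
    ENNReal.tendsto_pow_atTop_nhds_zero_of_lt_one
      (ENNReal.sub_lt_self ENNReal.one_ne_top one_ne_zero hε.ne')
  refine le_antisymm (ge_of_tendsto' hlim fun m => le_trans ?_ (hdecay m)) zero_le
  exact MeasureTheory.measure_mono fun π hπ n hkn _ => hπ n hkn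

/-- ergodicity property: Let `M` be a finite Markov chain and `C`
a bottom SCC of its underlying graph. For every state `s ∈ C` and every finite
path `ρ` lying entirely within `C`, the set of infinite paths starting at `s`
that visit `ρ` infinitely often (i.e. `ρ` occurs as a contiguous fragment
starting at infinitely many positions) has probability `1` under the path
measure of `M` with initial state `s`. -/
theorem bscc_ergodicity {S Al : Type} [Fintype S] [DecidableEq S]
    (M : MC S Al) (hM : ∀ s : S, ∑ t : S, M.P s t = 1)
    (C : Set S) (hC : IsBSCC M.E C)
    (s : S) (hs : s ∈ C)
    (ρ : List S) (hρ : FinPathIn M.E C ρ)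
    (μ : @MeasureTheory.Measure (ℕ → S) (CylSigma S))
    (hμ : IsPathMeasure M.P s μ) :
    μ {π : ℕ → S | π 0 = s ∧
        {n : ℕ | ∀ i : Fin ρ.length, π (n + i.1) = ρ.get i}.Infinite} = 1 := by
  let _ := CylSigma S
  have hae : μ {π : ℕ → S | π 0 = s ∧ {n : ℕ | OccursAt ρ π n}.Infinite}ᶜ = 0 := by
    refine MeasureTheory.measure_mono_null (t := {π | π 0 = s}ᶜ ∪
      ⋃ k, {π | ∀ n, k ≤ n → ¬ OccursAt ρ π n}) (fun π hπ => ?_)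
      (MeasureTheory.measure_union_null hμ.measure_start_compl (MeasureTheory.measure_iUnion_null
        (measure_not_occursAt_eq_zero M hC hs hρ hμ)))
    by_contra hnot
    simp only [Set.mem_union, Set.mem_compl_iff, Set.mem_iUnion, Set.mem_ofPred_eq, not_or,
      not_not, not_exists, not_forall] at hnot
    refine hπ ⟨hnot.1, Set.infinite_of_not_bddAbove ?_⟩
    rintro ⟨k, hk⟩
    obtain ⟨n, hkn, hocc⟩ := hnot.2 (k + 1)
    exact absurd (hk hocc) (by omega)
  rw [← hμ.measure_univ]
  exact MeasureTheory.measure_congr (MeasureTheory.ae_eq_univ.2 hae)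
end
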